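/- arXiv:1803.09154 — 2 statements merged into one kernel-verified Lean document; each statement's English description precedes it below -/
import Mathlib

section
/- If ⊥ is a regular orthogonality relation on a set X, then (X \ A^⊥)^⊥ = A^⊥ for all subsets A of X. -/
/-- `A^⊥` for an orthogonality relation. -/
def orthCompl {X : Type*} (perp : Set X → Set X → Prop) (A : Set X) : Set X :=
  {x : X | x ∉ A ∧ perp {x} A}

/-- `C` and `D` `⊥`-span `X`. -/
def perpSpan {X : Type*} (perp : Set X → Set X → Prop) (C D : Set X) : Prop :=
  perp C D ∧ ∃ C' D' : Set X, C' ∪ D' = Set.univ ∧ perp C' D ∧ perp D' C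

theorem stmt_6 {X : Type*} (perp : Set X → Set X → Prop)
    (hsymm : ∀ A B : Set X, perp A B → perp B A)
    (hzero : perp ∅ Set.univ)
    (hunion : ∀ A C C' : Set X, perp A (C ∪ C') ↔ (perp A C ∧ perp A C'))
    (hFrechet : ∀ x y : X, x ≠ y → perp {x} {y})
    (hreg : ∀ (x : X) (A : Set X), perp {x} A → perpSpan perp {x} A)
    (hbd : ∀ x : X, perp {x} {x} → perp {x} Set.univ)
    (A : Set X) :
    orthCompl perp (Set.univ \ orthCompl perp A) = orthCompl perp A := by
  have mono : ∀ S T U : Set X, T ⊆ U → perp S U → perp S T := by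
    intro S T U h hp
    have h2 : T ∪ U = U := Set.union_eq_self_of_subset_left h
    rw [← h2] at hp
    exact ((hunion S T U).1 hp).1
  ext x
  constructor
  · rintro ⟨h1, -⟩
    by_contra h
    exact h1 ⟨trivial, h⟩
  · intro hx
    refine ⟨fun h => h.2 hx, ?_⟩
    obtain ⟨-, C', D', hU, hC, hD⟩ := hreg x A hx.2
    refine mono {x} _ (A ∪ D') ?_ ((hunion _ _ _).2 ⟨hx.2, hsymm _ _ hD⟩)
    rintro y ⟨-, hy⟩
    by_cases hyA : y ∈ A
    · exact Or.inl hyA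
    · right
      have hyU : y ∈ C' ∪ D' := hU ▸ Set.mem_univ y
      rcases hyU with h | h
      · exact absurd ⟨hyA, hsymm _ _ (mono A {y} C' (Set.singleton_subset_iff.2 h) (hsymm _ _ hC))⟩ hy
      · exact h
end

section
/- Given a metric space X equipped with the large scale metric orthogonality relation and a metric space Y with the same, a function f : X → Y that preserves metrically bounded sets is ⊥-continuous if and only if f is coarse (point-inverses of bounded sets are bounded) and bornologous (for each r > 0 there is s > 0 such that diam(A) < r implies diam(f(A)) < s). -/
open Metric

/-- Open `r`-neighborhood of a set. -/
def nbd {X : Type*} [PseudoMetricSpace X] (A : Set X) (r : ℝ) : Set X :=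
  {x : X | ∃ a ∈ A, dist x a < r}

/-- Large scale metric orthogonality. -/
def lsPerp {X : Type*} [PseudoMetricSpace X] (A C : Set X) : Prop :=
  ∀ r > (0 : ℝ), Bornology.IsBounded (nbd A r ∩ nbd C r)

theorem stmt_11 {X Y : Type*} [PseudoMetricSpace X] [PseudoMetricSpace Y]
    (f : X → Y)
    (hpres : ∀ A : Set X, Bornology.IsBounded A → Bornology.IsBounded (f '' A)) :
    (∀ A C : Set Y, lsPerp A C → lsPerp (f ⁻¹' A) (f ⁻¹' C)) ↔
    ((∀ B : Set Y, Bornology.IsBounded B → Bornology.IsBounded (f ⁻¹' B)) ∧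
     (∀ r > (0 : ℝ), ∃ s > (0 : ℝ), ∀ x y : X, dist x y ≤ r → dist (f x) (f y) ≤ s)) := by
  constructor
  · intro h
    have hc : ∀ B : Set Y, Bornology.IsBounded B → Bornology.IsBounded (f ⁻¹' B) := by
      intro B hB
      have hBB : lsPerp B B := by
        intro r hr
        refine (hB.cthickening (δ := r)).subset ?_
        rintro z ⟨⟨a, ha, hza⟩, -⟩
        exact mem_cthickening_of_dist_le z a r B ha hza.le
      refine (h B B hBB 1 one_pos).subset ?_
      intro x hx
      exact ⟨⟨x, hx, by simp⟩, ⟨x, hx, by simp⟩⟩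
    refine ⟨hc, ?_⟩
    by_contra hcon
    push Not at hcon
    obtain ⟨r, hr, hbad⟩ := hcon
    obtain ⟨x0, -, -, -⟩ := hbad 1 one_pos
    set p := f x0 with hp
    have key : ∀ R : ℝ, ∃ q : X × X, dist q.1 q.2 ≤ r ∧ R < dist (f q.1) (f q.2) ∧
        R < dist (f q.1) p ∧ R < dist (f q.2) p := by
      intro R
      by_contra hno
      push Not at hno
      have hS := hc _ (isBounded_closedBall (x := p) (r := R))
      have hT := hpres _ (hS.cthickening (δ := r))
      obtain ⟨D, hD⟩ := Metric.isBounded_iff.1 hT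
      obtain ⟨x, y, hxy, hlt⟩ := hbad (max 1 (max D R)) (by positivity)
      have h1 : D < dist (f x) (f y) :=
        lt_of_le_of_lt ((le_max_left _ _).trans (le_max_right _ _)) hlt
      have h2 : R < dist (f x) (f y) :=
        lt_of_le_of_lt ((le_max_right _ _).trans (le_max_right _ _)) hlt
      have hmem : x ∈ cthickening r (f ⁻¹' closedBall p R) ∧
          y ∈ cthickening r (f ⁻¹' closedBall p R) := by
        by_cases hx : dist (f x) p ≤ R
        · have hx' : x ∈ f ⁻¹' closedBall p R := hx
          exact ⟨self_subset_cthickening _ hx',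
            mem_cthickening_of_dist_le y x r _ hx' (by rwa [dist_comm])⟩
        · have hy' : y ∈ f ⁻¹' closedBall p R := hno (x, y) hxy h2 (not_le.1 hx)
          exact ⟨mem_cthickening_of_dist_le x y r _ hy' hxy,
            self_subset_cthickening _ hy'⟩
      have := hD (Set.mem_image_of_mem f hmem.1) (Set.mem_image_of_mem f hmem.2)
      linarith
    choose g hg1 hg2 hg3 hg4 using key
    let R : ℕ → ℝ := fun n => Nat.rec (0 : ℝ)
      (fun _ t => t + 1 + 2 * (dist (f (g t).1) p + dist (f (g t).2) p)) n
    have hRs : ∀ n, R (n + 1) =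
      R n + 1 + 2 * (dist (f (g (R n)).1) p + dist (f (g (R n)).2) p) := fun n => rfl
    have hR0 : R 0 = 0 := rfl
    clear_value R
    have hmono : Monotone R := by
      apply monotone_nat_of_le_succ
      intro n
      rw [hRs]
      have := dist_nonneg (x := f (g (R n)).1) (y := p)
      have := dist_nonneg (x := f (g (R n)).2) (y := p)
      linarith
    have hn : ∀ n : ℕ, (n : ℝ) ≤ R n := by
      intro n
      induction n with
      | zero => simp [hR0]
      | succ n ih =>
        rw [hRs]
        have := dist_nonneg (x := f (g (R n)).1) (y := p)
        have := dist_nonneg (x := f (g (R n)).2) (y := p)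
        push_cast
        linarith
    have hx : ∀ n m : ℕ, n < m → 2 * dist (f (g (R n)).1) p ≤ R m := by
      intro n m hnm
      have h1 := hmono (Nat.succ_le_of_lt hnm)
      have h2 := hRs n
      have := dist_nonneg (x := f (g (R n)).2) (y := p)
      have h3 := hn n
      have h4 : (0 : ℝ) ≤ n := n.cast_nonneg
      simp only [Nat.succ_eq_add_one] at h1
      linarith
    have hy : ∀ n m : ℕ, n < m → 2 * dist (f (g (R n)).2) p ≤ R m := by
      intro n m hnm
      have h1 := hmono (Nat.succ_le_of_lt hnm)
      have h2 := hRs n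
      have := dist_nonneg (x := f (g (R n)).1) (y := p)
      have h3 := hn n
      have h4 : (0 : ℝ) ≤ n := n.cast_nonneg
      simp only [Nat.succ_eq_add_one] at h1
      linarith
    have hsep : ∀ n m : ℕ, R n ≤ 2 * dist (f (g (R n)).1) (f (g (R m)).2) := by
      intro n m
      rcases lt_trichotomy n m with hnm | hnm | hnm
      · have h1 := hx n m hnm
        have h2 := hg4 (R m)
        have h3 := dist_triangle_left (f (g (R m)).2) p (f (g (R n)).1)
        have h4 := hmono hnm.le
        linarith
      · subst hnm
        have h1 := hg2 (R n)
        have := dist_nonneg (x := f (g (R n)).1) (y := f (g (R n)).2)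
        linarith
      · have h1 := hy m n hnm
        have h2 := hg3 (R n)
        have h3 := dist_triangle (f (g (R n)).1) (f (g (R m)).2) p
        linarith
    have hperp : lsPerp (Set.range fun n => f (g (R n)).1) (Set.range fun n => f (g (R n)).2) := by
      intro s hs
      refine (isBounded_closedBall (x := p) (r := s + R (⌈4 * s⌉₊ + 1))).subset ?_
      rintro z ⟨⟨_, ⟨n, rfl⟩, h1⟩, ⟨_, ⟨m, rfl⟩, h2⟩⟩
      simp only at h1 h2
      have h3 := dist_triangle_left (f (g (R n)).1) (f (g (R m)).2) z
      have h4 := hsep n m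
      have h5 := hn n
      have h6 : n ≤ ⌈4 * s⌉₊ := by
        have : (n : ℝ) ≤ ⌈4 * s⌉₊ := le_trans (by linarith) (Nat.le_ceil _)
        exact_mod_cast this
      have h7 := hx n (⌈4 * s⌉₊ + 1) (by omega)
      have h8 := dist_triangle z (f (g (R n)).1) p
      have := dist_nonneg (x := f (g (R n)).1) (y := p)
      rw [mem_closedBall]
      linarith
    have hb := hpres _ (h _ _ hperp (r + 1) (by linarith))
    obtain ⟨D, hD⟩ := (Metric.isBounded_iff_subset_closedBall p).1 hb
    obtain ⟨n, hnD⟩ := exists_nat_gt D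
    have hm : f (g (R n)).1 ∈ closedBall p D := by
      apply hD
      refine ⟨(g (R n)).1, ⟨⟨(g (R n)).1, ⟨n, rfl⟩, ?_⟩, ⟨(g (R n)).2, ⟨n, rfl⟩, ?_⟩⟩, rfl⟩
      · rw [dist_self]; linarith
      · linarith [hg1 (R n)]
    rw [mem_closedBall] at hm
    linarith [hg3 (R n), hn n]
  · rintro ⟨hc, hb⟩ A C hAC r hr
    obtain ⟨s, hs, hsr⟩ := hb r hr
    refine (hc _ (hAC (s + 1) (by linarith))).subset ?_
    rintro z ⟨⟨a, ha, hza⟩, ⟨c, hcC, hzc⟩⟩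
    exact ⟨⟨f a, ha, by linarith [hsr z a hza.le]⟩, ⟨f c, hcC, by linarith [hsr z c hzc.le]⟩⟩
end
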